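/- For every t > 0, every ℓ ∈ {1,…,n−1}, and every x ∈ ℝⁿ with x_ℓ = x_{ℓ+1}, the function F̃_n satisfies the boundary condition ∂F̃_n/∂x_{ℓ+1}(x,t) − τ ∂F̃_n/∂x_ℓ(x,t) = 0. -/

import Mathlib

open MeasureTheory Filter Set

/-- The point on the vertical contour `Γ_a` at height `φ`. -/
noncomputable def lineZ (a φ : ℝ) : ℂ := (a : ℂ) + φ * Complex.I

/-- The contour-integral formula `F̃_n(x,t)` with nested contours `Γ_{a_1}, …, Γ_{a_n}`;
each contour integral carries the conventional prefactor `1/(2πi)`, i.e. it is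
`(1/(2π)) ∫_ℝ dφ` of the integrand evaluated at `a_j + iφ`. -/
noncomputable def Ftilde (n : ℕ) (τ : ℝ) (a : Fin n → ℝ) (x : Fin n → ℝ) (t : ℝ) : ℂ :=
  (τ : ℂ) ^ (n * (n - 1) / 2) * (1 / (2 * Real.pi)) ^ n *
    ∫ φ : Fin n → ℝ,
      (∏ j : Fin n,
        (1 / lineZ (a j) (φ j)) * (((τ : ℂ) - 1) / (lineZ (a j) (φ j) + (1 - (τ : ℂ)))) *
          Complex.exp ((x j : ℂ) * lineZ (a j) (φ j) + (t : ℂ) / 2 * lineZ (a j) (φ j) ^ 2)) *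
      ∏ pr ∈ Finset.univ.filter (fun pr : Fin n × Fin n => pr.1 < pr.2),
        ((lineZ (a pr.2) (φ pr.2) - lineZ (a pr.1) (φ pr.1)) /
          (lineZ (a pr.2) (φ pr.2) - (τ : ℂ) * lineZ (a pr.1) (φ pr.1)))

theorem continuous_lineZ (a : ℝ) : Continuous (lineZ a) := by
  unfold lineZ; fun_prop

@[simp] theorem lineZ_re (a φ : ℝ) : (lineZ a φ).re = a := by simp [lineZ]

@[simp] theorem lineZ_im (a φ : ℝ) : (lineZ a φ).im = φ := by simp [lineZ]

theorem integrable_comp_lineZ {f : ℂ → ℂ} {a s K : ℝ} (hs : 0 < s)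
    (hf : ContinuousOn f (Complex.re ⁻¹' {a}))
    (hK : ∀ y, ‖f (lineZ a y)‖ ≤ K * Real.exp (-s * y ^ 2)) :
    Integrable fun y : ℝ => f (lineZ a y) := by
  refine Integrable.mono' ((integrable_exp_neg_mul_sq hs).const_mul K) ?_ (ae_of_all _ hK)
  exact (hf.comp_continuous (continuous_lineZ a) (by simp)).aestronglyMeasurable

/-- A function that is holomorphic and of Gaussian decay on a vertical strip has the same integral
along both edges of the strip. -/
theorem integral_lineZ_eq_of_strip {f : ℂ → ℂ} {a b s K : ℝ} (hab : a ≤ b) (hs : 0 < s)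
    (hf : DifferentiableOn ℂ f (Complex.re ⁻¹' Icc a b))
    (hK : ∀ r ∈ Icc a b, ∀ y, ‖f (lineZ r y)‖ ≤ K * Real.exp (-s * y ^ 2)) :
    ∫ y, f (lineZ a y) = ∫ y, f (lineZ b y) := by
  have hint : ∀ r ∈ Icc a b, Integrable fun y : ℝ => f (lineZ r y) := fun r hr =>
    integrable_comp_lineZ hs (hf.continuousOn.mono fun z hz => by
      have hz' : z.re = r := hz
      simpa [hz'] using hr) (hK r hr)
  have hlim : ∀ r ∈ Icc a b, Tendsto (fun T : ℝ => ∫ y in -T..T, f (lineZ r y)) atTop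
      (nhds (∫ y, f (lineZ r y))) := fun r hr =>
    intervalIntegral_tendsto_integral (hint r hr) tendsto_neg_atTop_atBot tendsto_id
  have hsub := (hlim b ⟨hab, le_rfl⟩).sub (hlim a ⟨le_rfl, hab⟩)
  have hedge : ∀ T : ℝ, ‖∫ x in a..b, f (lineZ x T)‖ ≤ K * Real.exp (-s * T ^ 2) * |b - a| := by
    intro T
    refine intervalIntegral.norm_integral_le_of_norm_le_const fun x hx => hK x ?_ T
    rw [uIoc_of_le hab] at hx
    exact ⟨hx.1.le, hx.2⟩
  have hrect : ∀ T : ℝ, ‖(∫ y in -T..T, f (lineZ b y)) - ∫ y in -T..T, f (lineZ a y)‖ ≤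
      2 * (K * |b - a|) * Real.exp (-s * T ^ 2) := by
    intro T
    have h := Complex.integral_boundary_rect_eq_zero_of_differentiableOn f
      (lineZ a (-T)) (lineZ b T) (hf.mono fun z hz => by
        have := hz.1
        simpa [uIcc_of_le hab] using this)
    simp only [lineZ_re, lineZ_im, smul_eq_mul] at h
    change (∫ x in a..b, f (lineZ x (-T))) - (∫ x in a..b, f (lineZ x T)) +
      Complex.I * (∫ y in -T..T, f (lineZ b y)) -
      Complex.I * (∫ y in -T..T, f (lineZ a y)) = 0 at h
    have h' : (∫ y in -T..T, f (lineZ b y)) - ∫ y in -T..T, f (lineZ a y) =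
        Complex.I * ((∫ x in a..b, f (lineZ x (-T))) - (∫ x in a..b, f (lineZ x T))) := by
      linear_combination (-Complex.I) * h + ((∫ y in -T..T, f (lineZ b y)) -
        ∫ y in -T..T, f (lineZ a y)) * Complex.I_sq
    rw [h', norm_mul, Complex.norm_I, one_mul]
    refine (norm_sub_le _ _).trans ?_
    have h1 := hedge T
    have h2 := hedge (-T)
    rw [neg_sq] at h2
    linarith
  have hexp : Tendsto (fun T : ℝ => Real.exp (-s * T ^ 2)) atTop (nhds 0) := by
    refine Real.tendsto_exp_atBot.comp ?_
    exact (tendsto_pow_atTop two_ne_zero).const_mul_atTop_of_neg (neg_lt_zero.2 hs)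
  have hzero := squeeze_zero_norm hrect (by simpa using hexp.const_mul (2 * (K * |b - a|)))
  exact (sub_eq_zero.1 (tendsto_nhds_unique hsub hzero)).symm

/-- Contour shift in one coordinate of a multiple contour integral. -/
theorem integral_lineZ_update_eq {n : ℕ} {H : (Fin n → ℂ) → ℂ} {a : Fin n → ℝ} {ℓ : Fin n}
    {b s K : ℝ} (hab : a ℓ ≤ b) (hs : 0 < s)
    (hd : ∀ r ∈ Icc (a ℓ) b, ∀ z : Fin n → ℂ, (∀ j, (z j).re = Function.update a ℓ r j) →
      DifferentiableAt ℂ H z)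
    (hK : ∀ r ∈ Icc (a ℓ) b, ∀ φ : Fin n → ℝ,
      ‖H fun j => lineZ (Function.update a ℓ r j) (φ j)‖ ≤ K * ∏ j, Real.exp (-s * φ j ^ 2)) :
    ∫ φ : Fin n → ℝ, H (fun j => lineZ (a j) (φ j)) =
      ∫ φ : Fin n → ℝ, H (fun j => lineZ (Function.update a ℓ b j) (φ j)) := by
  obtain ⟨m, rfl⟩ : ∃ m, n = m + 1 := ⟨n - 1, by have := ℓ.pos; omega⟩
  have hint : ∀ r ∈ Icc (a ℓ) b, Integrable fun φ : Fin (m + 1) → ℝ =>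
      H fun j => lineZ (Function.update a ℓ r j) (φ j) := by
    intro r hr
    refine Integrable.mono' ((Integrable.fintype_prod (μ := fun _ => (volume : Measure ℝ))
      fun _ => integrable_exp_neg_mul_sq hs).const_mul K) ?_ (ae_of_all _ (hK r hr))
    refine Continuous.aestronglyMeasurable (continuous_iff_continuousAt.2 fun φ => ?_)
    refine ContinuousAt.comp (f := fun φ : Fin (m + 1) → ℝ => fun j =>
      lineZ (Function.update a ℓ r j) (φ j)) (hd r hr _ fun j => by simp).continuousAt ?_
    refine Continuous.continuousAt (continuous_pi fun j => ?_)
    exact (continuous_lineZ _).comp (continuous_apply j)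
  have hsplit : ∀ r ∈ Icc (a ℓ) b,
      ∫ φ : Fin (m + 1) → ℝ, H (fun j => lineZ (Function.update a ℓ r j) (φ j)) =
      ∫ ψ : Fin m → ℝ, ∫ y : ℝ,
        H (fun j => lineZ (Function.update a ℓ r j) (Fin.insertNth (α := fun _ => ℝ) ℓ y ψ j)) := by
    intro r hr
    have hmp := (volume_preserving_piFinSuccAbove (fun _ : Fin (m + 1) => ℝ) ℓ).symm _
    rw [← hmp.integral_comp' (g := fun φ : Fin (m + 1) → ℝ =>
      H (fun j => lineZ (Function.update a ℓ r j) (φ j))), Measure.volume_eq_prod,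
      integral_prod_symm]
    · rfl
    · exact (hmp.integrable_comp_emb (MeasurableEquiv.measurableEmbedding _)).2 (hint r hr)
  have h0 := hsplit (a ℓ) ⟨le_rfl, hab⟩
  rw [Function.update_eq_self] at h0
  rw [h0, hsplit b ⟨hab, le_rfl⟩]
  congr 1
  ext ψ
  let f : ℂ → ℂ := fun ζ => H fun j =>
    Function.update (fun j => lineZ (a j) (Fin.insertNth (α := fun _ => ℝ) ℓ 0 ψ j)) ℓ ζ j
  have hf : ∀ r y, H (fun j => lineZ (Function.update a ℓ r j) (Fin.insertNth (α := fun _ => ℝ) ℓ y ψ j)) =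
      f (lineZ r y) := by
    intro r y
    simp only [f]
    congr 1
    ext j
    refine Fin.succAboveCases ℓ ?_ (fun i => ?_) j
    · simp
    · simp [Fin.succAbove_ne]
  have hf0 := fun y => hf (a ℓ) y
  rw [Function.update_eq_self] at hf0
  simp_rw [hf0, hf]
  refine integral_lineZ_eq_of_strip (K := K * ∏ i, Real.exp (-s * ψ i ^ 2)) hab hs ?_ ?_
  · intro ζ hζ
    refine DifferentiableAt.differentiableWithinAt ?_
    refine DifferentiableAt.comp ζ (g := H) (hd ζ.re hζ _ fun j => ?_) ?_
    · by_cases hj : j = ℓ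
      · subst hj; simp
      · simp [hj]
    · refine differentiableAt_pi.2 fun j => ?_
      by_cases hj : j = ℓ
      · subst hj; simp
      · simp [hj]
  · intro r hr y
    rw [← hf]
    refine (hK r hr _).trans_eq ?_
    rw [Fin.prod_univ_succAbove _ ℓ]
    simp
    ring

/-- The single-variable factor of the integrand of `Ftilde`. -/
noncomputable def singleFactor (τ t ξ : ℝ) (z : ℂ) : ℂ :=
  (1 / z) * (((τ : ℂ) - 1) / (z + (1 - (τ : ℂ)))) *
    Complex.exp ((ξ : ℂ) * z + (t : ℂ) / 2 * z ^ 2)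

/-- The integrand of `Ftilde`, with the product of the cross factors restricted to `S`. -/
noncomputable def crossKernel {n : ℕ} (τ t : ℝ) (x : Fin n → ℝ) (S : Finset (Fin n × Fin n))
    (z : Fin n → ℂ) : ℂ :=
  (∏ j, singleFactor τ t (x j) (z j)) *
    ∏ pr ∈ S, ((z pr.2 - z pr.1) / (z pr.2 - (τ : ℂ) * z pr.1))

/-- On contours with real parts `c`, all denominators of `crossKernel τ t x S` have real part at
distance at least `δ` from `0`. -/
structure ContourGap {n : ℕ} (τ δ : ℝ) (S : Finset (Fin n × Fin n)) (c : Fin n → ℝ) : Prop where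
  low : ∀ j, δ ≤ c j + (1 - τ)
  up : ∀ j, c j ≤ -δ
  cross : ∀ pr ∈ S, δ ≤ c pr.2 - τ * c pr.1

theorem le_norm_of_le_re {z : ℂ} {δ : ℝ} (h : δ ≤ z.re) : δ ≤ ‖z‖ :=
  h.trans (Complex.re_le_norm z)

theorem le_norm_of_re_le_neg {z : ℂ} {δ : ℝ} (h : z.re ≤ -δ) : δ ≤ ‖z‖ :=
  (le_abs.2 (Or.inr (by linarith))).trans (Complex.abs_re_le_norm z)

namespace ContourGap

variable {n : ℕ} {τ δ : ℝ} {S : Finset (Fin n × Fin n)} {c : Fin n → ℝ}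

theorem le_norm (h : ContourGap τ δ S c) {z : Fin n → ℂ} (hz : ∀ j, (z j).re = c j) (j : Fin n) :
    δ ≤ ‖z j‖ :=
  le_norm_of_re_le_neg (by rw [hz]; exact h.up j)

theorem le_norm_add (h : ContourGap τ δ S c) {z : Fin n → ℂ} (hz : ∀ j, (z j).re = c j)
    (j : Fin n) : δ ≤ ‖z j + (1 - (τ : ℂ))‖ :=
  le_norm_of_le_re (by simpa [hz] using h.low j)

theorem le_norm_sub (h : ContourGap τ δ S c) {z : Fin n → ℂ} (hz : ∀ j, (z j).re = c j)
    {pr : Fin n × Fin n} (hpr : pr ∈ S) : δ ≤ ‖z pr.2 - (τ : ℂ) * z pr.1‖ :=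
  le_norm_of_le_re (by simpa [hz] using h.cross pr hpr)

theorem abs_le_one (h : ContourGap τ δ S c) (hτ : 0 ≤ τ) (hδ : 0 ≤ δ) (j : Fin n) :
    |c j| ≤ 1 := by
  have h1 := h.low j
  have h2 := h.up j
  exact abs_le.2 ⟨by linarith, by linarith⟩

end ContourGap

theorem differentiableAt_finsetProd {ι E : Type*} [NormedAddCommGroup E] [NormedSpace ℂ E]
    {s : Finset ι} {f : ι → E → ℂ} {z : E} (h : ∀ i ∈ s, DifferentiableAt ℂ (f i) z) :
    DifferentiableAt ℂ (fun w => ∏ i ∈ s, f i w) z := by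
  classical
  exact (HasFDerivAt.finsetProd fun i hi => (h i hi).hasFDerivAt).differentiableAt

theorem differentiableAt_crossKernel {n : ℕ} {τ δ t : ℝ} {S : Finset (Fin n × Fin n)}
    {c : Fin n → ℝ} (hδ : 0 < δ) (h : ContourGap τ δ S c) (x : Fin n → ℝ) {z : Fin n → ℂ}
    (hz : ∀ j, (z j).re = c j) : DifferentiableAt ℂ (crossKernel τ t x S) z := by
  unfold crossKernel singleFactor
  refine DifferentiableAt.mul ?_ ?_
  · refine differentiableAt_finsetProd fun j _ => ?_
    have h1 : z j ≠ 0 := norm_pos_iff.1 (hδ.trans_le (h.le_norm hz j))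
    have h2 : z j + (1 - (τ : ℂ)) ≠ 0 := norm_pos_iff.1 (hδ.trans_le (h.le_norm_add hz j))
    fun_prop (disch := assumption)
  · refine differentiableAt_finsetProd fun pr hpr => ?_
    have h1 : z pr.2 - (τ : ℂ) * z pr.1 ≠ 0 :=
      norm_pos_iff.1 (hδ.trans_le (h.le_norm_sub hz hpr))
    fun_prop (disch := assumption)

theorem norm_lineZ_le {c : ℝ} (hc : |c| ≤ 1) (φ : ℝ) : ‖lineZ c φ‖ ≤ 1 + |φ| := by
  refine (Complex.norm_le_abs_re_add_abs_im _).trans ?_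
  simpa using hc

theorem norm_singleFactor_lineZ_le {τ t δ M ξ c φ : ℝ} (hτ : τ ∈ Ioo (0 : ℝ) 1) (ht : 0 < t)
    (hδ : 0 < δ) (hξ : |ξ| ≤ M) (hc : |c| ≤ 1) (h1 : δ ≤ ‖lineZ c φ‖)
    (h2 : δ ≤ ‖lineZ c φ + (1 - (τ : ℂ))‖) :
    ‖singleFactor τ t ξ (lineZ c φ)‖ ≤
      1 / δ * (1 / δ) * Real.exp (M + t / 2) * Real.exp (-(t / 2) * φ ^ 2) := by
  have hexp : ‖Complex.exp ((ξ : ℂ) * lineZ c φ + (t : ℂ) / 2 * lineZ c φ ^ 2)‖ ≤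
      Real.exp (M + t / 2) * Real.exp (-(t / 2) * φ ^ 2) := by
    rw [Complex.norm_exp, ← Real.exp_add]
    refine Real.exp_le_exp.2 ?_
    have hre : ((ξ : ℂ) * lineZ c φ + (t : ℂ) / 2 * lineZ c φ ^ 2).re =
        ξ * c + t / 2 * (c ^ 2 - φ ^ 2) := by
      have : (t : ℂ) / 2 = ((t / 2 : ℝ) : ℂ) := by push_cast; ring
      rw [this, Complex.add_re, Complex.re_ofReal_mul, Complex.re_ofReal_mul, sq, Complex.mul_re]
      simp only [lineZ_re, lineZ_im]
      ring
    have hξc : ξ * c ≤ M := by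
      refine (le_abs_self _).trans ?_
      rw [abs_mul]
      nlinarith [abs_nonneg ξ, abs_nonneg c]
    have hc2 : c ^ 2 ≤ 1 := (sq_le_one_iff_abs_le_one c).2 hc
    rw [hre]
    nlinarith
  have hnum : ‖(τ : ℂ) - 1‖ ≤ 1 := by
    rw [← Complex.ofReal_one, ← Complex.ofReal_sub, Complex.norm_real, Real.norm_eq_abs, abs_le]
    exact ⟨by linarith [hτ.1], by linarith [hτ.2]⟩
  unfold singleFactor
  rw [norm_mul, norm_mul, norm_div, norm_div, norm_one, mul_assoc _ (Real.exp _)]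
  gcongr

theorem norm_crossFactor_le {τ δ p : ℝ} {z w : ℂ} (hδ : 0 < δ) (hp : 1 ≤ p)
    (hz : ‖z‖ ≤ p) (hw : ‖w‖ ≤ p) (h : δ ≤ ‖w - (τ : ℂ) * z‖) :
    ‖(w - z) / (w - (τ : ℂ) * z)‖ ≤ 2 / δ * p := by
  rw [norm_div, div_mul_eq_mul_div]
  have := norm_sub_le w z
  gcongr
  linarith

theorem one_le_prod_one_add_abs {n : ℕ} (φ : Fin n → ℝ) : 1 ≤ ∏ j, (1 + |φ j|) :=
  Finset.one_le_prod fun j _ => by have := abs_nonneg (φ j); linarith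

theorem one_add_abs_le_prod {n : ℕ} (φ : Fin n → ℝ) (k : Fin n) :
    1 + |φ k| ≤ ∏ j, (1 + |φ j|) := by
  rw [← Finset.mul_prod_erase _ _ (Finset.mem_univ k)]
  refine le_mul_of_one_le_right (by positivity) ?_
  exact Finset.one_le_prod fun j _ => by have := abs_nonneg (φ j); linarith

theorem pow_mul_exp_neg_sq_le {t : ℝ} (ht : 0 < t) (N : ℕ) (y : ℝ) :
    (1 + |y|) ^ N * Real.exp (-(t / 2) * y ^ 2) ≤
      Real.exp (N ^ 2 / t) * Real.exp (-(t / 4) * y ^ 2) := by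
  have h1 : (1 + |y|) ^ N ≤ Real.exp (N * |y|) := by
    rw [Real.exp_nat_mul]
    gcongr
    linarith [Real.add_one_le_exp |y|]
  calc _ ≤ Real.exp (N * |y|) * Real.exp (-(t / 2) * y ^ 2) := by gcongr
    _ ≤ _ := by
      rw [← Real.exp_add, ← Real.exp_add]
      refine Real.exp_le_exp.2 ?_
      have h2 : (N : ℝ) ^ 2 / t + -(t / 4) * y ^ 2 - (N * |y| + -(t / 2) * y ^ 2) =
          (t * |y| / 2 - N) ^ 2 / t := by
        rw [← sq_abs y]
        field_simp
        ring
      have h3 : 0 ≤ (t * |y| / 2 - N) ^ 2 / t := by positivity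
      linarith

/-- Gaussian bound for `crossKernel`, uniform over contours with a fixed gap. -/
theorem exists_norm_crossKernel_le {n : ℕ} {τ t δ : ℝ} (hτ : τ ∈ Ioo (0 : ℝ) 1) (ht : 0 < t)
    (hδ : 0 < δ) (S : Finset (Fin n × Fin n)) (x : Fin n → ℝ) :
    ∃ C : ℝ, ∀ c : Fin n → ℝ, ContourGap τ δ S c → ∀ φ : Fin n → ℝ,
      ‖crossKernel τ t x S fun j => lineZ (c j) (φ j)‖ * ∏ j, (1 + |φ j|) ≤
        C * ∏ j, Real.exp (-(t / 4) * φ j ^ 2) := by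
  obtain ⟨M, hM⟩ : ∃ M : ℝ, ∀ j, |x j| ≤ M :=
    ⟨∑ j, |x j|, fun j => Finset.single_le_sum (fun i _ => abs_nonneg (x i)) (Finset.mem_univ j)⟩
  set N := S.card + 1
  refine ⟨(∏ _j : Fin n, 1 / δ * (1 / δ) * Real.exp (M + t / 2)) * (2 / δ) ^ S.card *
    ∏ _j : Fin n, Real.exp (N ^ 2 / t), fun c hc φ => ?_⟩
  set P := ∏ j, (1 + |φ j|)
  have hP : 1 ≤ P := one_le_prod_one_add_abs φ
  have hre : ∀ j, (lineZ (c j) (φ j)).re = c j := fun j => lineZ_re _ _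
  have hc1 := hc.abs_le_one hτ.1.le hδ.le
  have hzP : ∀ j, ‖lineZ (c j) (φ j)‖ ≤ P := fun j =>
    (norm_lineZ_le (hc1 j) _).trans (one_add_abs_le_prod φ j)
  have hsingle : ‖∏ j, singleFactor τ t (x j) (lineZ (c j) (φ j))‖ ≤
      (∏ _j : Fin n, 1 / δ * (1 / δ) * Real.exp (M + t / 2)) *
        ∏ j, Real.exp (-(t / 2) * φ j ^ 2) := by
    rw [norm_prod, ← Finset.prod_mul_distrib]
    exact Finset.prod_le_prod (fun _ _ => norm_nonneg _) fun j _ =>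
      norm_singleFactor_lineZ_le hτ ht hδ (hM j) (hc1 j) (hc.le_norm hre j) (hc.le_norm_add hre j)
  have hcross : ‖∏ pr ∈ S, ((lineZ (c pr.2) (φ pr.2) - lineZ (c pr.1) (φ pr.1)) /
      (lineZ (c pr.2) (φ pr.2) - (τ : ℂ) * lineZ (c pr.1) (φ pr.1)))‖ ≤
      (2 / δ) ^ S.card * P ^ S.card := by
    rw [norm_prod, ← mul_pow]
    rw [← Finset.prod_const]
    exact Finset.prod_le_prod (fun _ _ => norm_nonneg _) fun pr hpr =>
      norm_crossFactor_le hδ hP (hzP _) (hzP _) (hc.le_norm_sub hre hpr)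
  have hpoly : P ^ N * ∏ j, Real.exp (-(t / 2) * φ j ^ 2) ≤
      (∏ _j : Fin n, Real.exp (N ^ 2 / t)) * ∏ j, Real.exp (-(t / 4) * φ j ^ 2) := by
    rw [← Finset.prod_pow, ← Finset.prod_mul_distrib, ← Finset.prod_mul_distrib]
    exact Finset.prod_le_prod (fun _ _ => by positivity) fun j _ => pow_mul_exp_neg_sq_le ht N _
  have hA : 0 ≤ ∏ _j : Fin n, 1 / δ * (1 / δ) * Real.exp (M + t / 2) :=
    Finset.prod_nonneg fun _ _ => by positivity
  unfold crossKernel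
  rw [norm_mul]
  calc _ ≤ ((∏ _j : Fin n, 1 / δ * (1 / δ) * Real.exp (M + t / 2)) *
        ∏ j, Real.exp (-(t / 2) * φ j ^ 2)) * ((2 / δ) ^ S.card * P ^ S.card) * P := by
        gcongr
    _ = (∏ _j : Fin n, 1 / δ * (1 / δ) * Real.exp (M + t / 2)) * (2 / δ) ^ S.card *
        (P ^ N * ∏ j, Real.exp (-(t / 2) * φ j ^ 2)) := by
        simp only [N]; ring
    _ ≤ _ := by
        rw [mul_assoc _ (∏ _j : Fin n, Real.exp (N ^ 2 / t))]
        gcongr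

theorem exists_contourGap {n : ℕ} {τ : ℝ} (hτ : 0 ≤ τ) (S : Finset (Fin n × Fin n))
    {c c' : Fin n → ℝ} (hlow : ∀ j, 0 < c j + (1 - τ)) (hup : ∀ j, c' j < 0)
    (hcross : ∀ pr ∈ S, 0 < c pr.2 - τ * c' pr.1) :
    ∃ δ > 0, ∀ b : Fin n → ℝ, c ≤ b → b ≤ c' → ContourGap τ δ S b := by
  have hsmall : ∀ {y : ℝ}, 0 < y → ∀ᶠ δ in nhdsWithin (0 : ℝ) (Ioi 0), δ ≤ y := fun hy =>
    mem_nhdsWithin_of_mem_nhds (Iic_mem_nhds hy)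
  have h1 : ∀ᶠ δ in nhdsWithin (0 : ℝ) (Ioi 0), ∀ j, δ ≤ c j + (1 - τ) :=
    eventually_all.2 fun j => hsmall (hlow j)
  have h2 : ∀ᶠ δ in nhdsWithin (0 : ℝ) (Ioi 0), ∀ j, δ ≤ -c' j :=
    eventually_all.2 fun j => hsmall (neg_pos.2 (hup j))
  have h3 : ∀ᶠ δ in nhdsWithin (0 : ℝ) (Ioi 0), ∀ pr ∈ S, δ ≤ c pr.2 - τ * c' pr.1 :=
    (eventually_all_finset S).2 fun pr hpr => hsmall (hcross pr hpr)
  obtain ⟨δ, ⟨⟨h1, h2⟩, h3⟩, hδ⟩ := (((h1.and h2).and h3).and self_mem_nhdsWithin).exists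
  refine ⟨δ, hδ, fun b hcb hbc => ⟨fun j => ?_, fun j => ?_, fun pr hpr => ?_⟩⟩
  · linarith [h1 j, hcb j]
  · linarith [h2 j, hbc j]
  · linarith [h3 pr hpr, hcb pr.2, mul_le_mul_of_nonneg_left (hbc pr.1) hτ]

theorem crossKernel_mul_sub {n : ℕ} {τ t : ℝ} {S : Finset (Fin n × Fin n)} (x : Fin n → ℝ)
    {z : Fin n → ℂ} {k l : Fin n} (hkl : (k, l) ∈ S) (h : z l - (τ : ℂ) * z k ≠ 0) :
    crossKernel τ t x S z * (z l - (τ : ℂ) * z k) =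
      crossKernel τ t x (S.erase (k, l)) z * (z l - z k) := by
  unfold crossKernel
  rw [← Finset.mul_prod_erase S _ hkl]
  linear_combination (∏ j, singleFactor τ t (x j) (z j)) *
    (∏ pr ∈ S.erase (k, l), ((z pr.2 - z pr.1) / (z pr.2 - (τ : ℂ) * z pr.1))) *
    div_mul_cancel₀ (z l - z k) h

section Integral

variable {n : ℕ} {τ t δ : ℝ} {S : Finset (Fin n × Fin n)} {a : Fin n → ℝ}

theorem continuous_crossKernel_lineZ (hδ : 0 < δ) (ha : ContourGap τ δ S a) (x : Fin n → ℝ) :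
    Continuous fun φ : Fin n → ℝ => crossKernel τ t x S fun j => lineZ (a j) (φ j) := by
  refine continuous_iff_continuousAt.2 fun φ => ?_
  refine ContinuousAt.comp (f := fun φ : Fin n → ℝ => fun j => lineZ (a j) (φ j))
    (differentiableAt_crossKernel hδ ha x fun j => by simp).continuousAt ?_
  exact (continuous_pi fun j => (continuous_lineZ _).comp (continuous_apply j)).continuousAt

theorem integrable_prod_gaussian (n : ℕ) {s : ℝ} (hs : 0 < s) :
    Integrable fun φ : Fin n → ℝ => ∏ j, Real.exp (-s * φ j ^ 2) :=
  Integrable.fintype_prod (μ := fun _ => (volume : Measure ℝ)) fun _ =>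
    integrable_exp_neg_mul_sq hs

theorem integrable_crossKernel_mul_lineZ (hτ : τ ∈ Ioo (0 : ℝ) 1) (ht : 0 < t) (hδ : 0 < δ)
    (ha : ContourGap τ δ S a) (x : Fin n → ℝ) (k : Fin n) :
    Integrable fun φ : Fin n → ℝ =>
      crossKernel τ t x S (fun j => lineZ (a j) (φ j)) * lineZ (a k) (φ k) := by
  obtain ⟨C, hC⟩ := exists_norm_crossKernel_le hτ ht hδ S x
  refine Integrable.mono' ((integrable_prod_gaussian n (by positivity : 0 < t / 4)).const_mul C)
    ?_ (ae_of_all _ fun φ => ?_)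
  · exact ((continuous_crossKernel_lineZ hδ ha x).mul
      ((continuous_lineZ _).comp (continuous_apply k))).aestronglyMeasurable
  · rw [norm_mul]
    refine le_trans ?_ (hC a ha φ)
    gcongr
    exact (norm_lineZ_le (ha.abs_le_one hτ.1.le hδ.le k) _).trans (one_add_abs_le_prod φ k)

theorem integrable_crossKernel (hτ : τ ∈ Ioo (0 : ℝ) 1) (ht : 0 < t) (hδ : 0 < δ)
    (ha : ContourGap τ δ S a) (x : Fin n → ℝ) :
    Integrable fun φ : Fin n → ℝ => crossKernel τ t x S (fun j => lineZ (a j) (φ j)) := by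
  obtain ⟨C, hC⟩ := exists_norm_crossKernel_le hτ ht hδ S x
  refine Integrable.mono' ((integrable_prod_gaussian n (by positivity : 0 < t / 4)).const_mul C)
    (continuous_crossKernel_lineZ hδ ha x).aestronglyMeasurable (ae_of_all _ fun φ => ?_)
  exact (le_mul_of_one_le_right (norm_nonneg _) (one_le_prod_one_add_abs φ)).trans (hC a ha φ)

theorem crossKernel_update (x : Fin n → ℝ) (k : Fin n) (v : ℝ) (z : Fin n → ℂ) :
    crossKernel τ t (Function.update x k v) S z =
      crossKernel τ t x S z * Complex.exp (((v : ℂ) - x k) * z k) := by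
  have h : ∀ j, singleFactor τ t (Function.update x k v j) (z j) =
      singleFactor τ t (x j) (z j) *
        if j = k then Complex.exp (((v : ℂ) - x k) * z k) else 1 := by
    intro j
    split_ifs with hj
    · subst hj
      simp only [singleFactor, Function.update_self]
      rw [mul_assoc _ (Complex.exp _), ← Complex.exp_add]
      congr 2
      ring
    · simp [hj]
  unfold crossKernel
  simp_rw [h, Finset.prod_mul_distrib, Finset.prod_ite_eq', Finset.mem_univ, if_true]
  ring

theorem hasDerivAt_integral_crossKernel (hτ : τ ∈ Ioo (0 : ℝ) 1) (ht : 0 < t) (hδ : 0 < δ)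
    (ha : ContourGap τ δ S a) (x : Fin n → ℝ) (k : Fin n) :
    HasDerivAt (fun v : ℝ => ∫ φ : Fin n → ℝ,
        crossKernel τ t (Function.update x k v) S fun j => lineZ (a j) (φ j))
      (∫ φ : Fin n → ℝ, crossKernel τ t x S (fun j => lineZ (a j) (φ j)) * lineZ (a k) (φ k))
      (x k) := by
  have hint := integrable_crossKernel hτ ht hδ ha x
  have hint' := integrable_crossKernel_mul_lineZ hτ ht hδ ha x k
  have hcont := continuous_crossKernel_lineZ (t := t) hδ ha x
  have hak := ha.abs_le_one hτ.1.le hδ.le k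
  simp_rw [crossKernel_update]
  have key := hasDerivAt_integral_of_dominated_loc_of_deriv_le (𝕜 := ℝ)
    (μ := (volume : Measure (Fin n → ℝ))) (x₀ := x k) (s := Metric.ball (x k) 1)
    (F := fun (v : ℝ) (φ : Fin n → ℝ) => crossKernel τ t x S (fun j => lineZ (a j) (φ j)) *
      Complex.exp (((v : ℂ) - x k) * lineZ (a k) (φ k)))
    (F' := fun (v : ℝ) (φ : Fin n → ℝ) => crossKernel τ t x S (fun j => lineZ (a j) (φ j)) *
      (Complex.exp (((v : ℂ) - x k) * lineZ (a k) (φ k)) * (1 * lineZ (a k) (φ k))))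
    (bound := fun φ => ‖crossKernel τ t x S (fun j => lineZ (a j) (φ j)) * lineZ (a k) (φ k)‖ *
      Real.exp 1) (Metric.ball_mem_nhds _ one_pos) ?_ (by simpa using hint) (by
        simpa using hint'.aestronglyMeasurable) ?_ (hint'.norm.mul_const _) ?_
  · simpa using key.2
  · refine Eventually.of_forall fun v => (hcont.mul ?_).aestronglyMeasurable
    have := (continuous_lineZ (a k)).comp (continuous_apply (A := fun _ : Fin n => ℝ) k)
    exact Complex.continuous_exp.comp (continuous_const.mul this)
  · refine ae_of_all _ fun φ v hv => ?_
    rw [one_mul, norm_mul, norm_mul, norm_mul, mul_comm ‖Complex.exp _‖, ← mul_assoc]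
    gcongr
    rw [Complex.norm_exp, ← Complex.ofReal_sub, Complex.re_ofReal_mul, lineZ_re]
    refine Real.exp_le_exp.2 ((le_abs_self _).trans ?_)
    rw [Metric.mem_ball, Real.dist_eq] at hv
    rw [abs_mul]
    exact mul_le_one₀ hv.le (abs_nonneg _) hak
  · refine ae_of_all _ fun φ v _ => ?_
    have h : HasDerivAt (fun v : ℝ => ((v : ℂ) - x k) * lineZ (a k) (φ k))
        (1 * lineZ (a k) (φ k)) v :=
      ((Complex.ofRealCLM.hasDerivAt (x := v)).sub_const (x k : ℂ)).mul_const _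
    exact h.cexp.const_mul _

end Integral

/-- The ordered pairs of indices other than `(k, l)`. -/
def ltPairsErase {n : ℕ} (k l : Fin n) : Finset (Fin n × Fin n) :=
  (Finset.univ.filter fun pr : Fin n × Fin n => pr.1 < pr.2).erase (k, l)

theorem mem_ltPairsErase {n : ℕ} {k l : Fin n} {pr : Fin n × Fin n} :
    pr ∈ ltPairsErase k l ↔ pr ≠ (k, l) ∧ pr.1 < pr.2 := by
  simp [ltPairsErase]

theorem swap_mem_ltPairsErase {n : ℕ} {k l : Fin n} (hkl : (k : ℕ) + 1 = l)
    {pr : Fin n × Fin n} (hpr : pr ∈ ltPairsErase k l) :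
    (Equiv.swap k l pr.1, Equiv.swap k l pr.2) ∈ ltPairsErase k l := by
  obtain ⟨p, q⟩ := pr
  rw [mem_ltPairsErase] at hpr ⊢
  simp only [ne_eq, Prod.mk.injEq, Equiv.swap_apply_def, Fin.lt_def, Fin.ext_iff] at hpr ⊢
  grind

theorem crossKernel_comp_swap {n : ℕ} {τ t : ℝ} {x : Fin n → ℝ} {k l : Fin n}
    (hkl : (k : ℕ) + 1 = l) (hx : x k = x l) (z : Fin n → ℂ) :
    crossKernel τ t x (ltPairsErase k l) (fun j => z (Equiv.swap k l j)) =
      crossKernel τ t x (ltPairsErase k l) z := by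
  have hxs : ∀ j, x (Equiv.swap k l j) = x j := by
    intro j
    rw [Equiv.swap_apply_def]
    split_ifs with h1 h2
    · rw [h1, hx]
    · rw [h2, hx]
    · rfl
  unfold crossKernel
  congr 1
  · rw [← Equiv.prod_comp (Equiv.swap k l) fun j => singleFactor τ t (x j) (z j)]
    simp_rw [hxs]
  · exact Finset.prod_nbij' (fun pr => (Equiv.swap k l pr.1, Equiv.swap k l pr.2))
      (fun pr => (Equiv.swap k l pr.1, Equiv.swap k l pr.2))
      (fun _ => swap_mem_ltPairsErase hkl) (fun _ => swap_mem_ltPairsErase hkl)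
      (by simp) (by simp) (by simp)

theorem integral_eq_zero_of_swap_antisymm {n : ℕ} {H : (Fin n → ℂ) → ℂ} {c : Fin n → ℝ}
    {k l : Fin n} (hc : c k = c l)
    (hH : ∀ z, H (fun j => z (Equiv.swap k l j)) = -H z) :
    ∫ φ : Fin n → ℝ, H (fun j => lineZ (c j) (φ j)) = 0 := by
  have hcs : ∀ j, c (Equiv.swap k l j) = c j := by
    intro j
    rw [Equiv.swap_apply_def]
    split_ifs with h1 h2
    · rw [h1, hc]
    · rw [h2, hc]
    · rfl
  have hmp := volume_measurePreserving_piCongrLeft (fun _ : Fin n => ℝ) (Equiv.swap k l)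
  have h := hmp.integral_comp' (g := fun φ : Fin n → ℝ => H (fun j => lineZ (c j) (φ j)))
  have h' : ∀ φ : Fin n → ℝ, H (fun j => lineZ (c j)
      (MeasurableEquiv.piCongrLeft (fun _ : Fin n => ℝ) (Equiv.swap k l) φ j)) =
      -H (fun j => lineZ (c j) (φ j)) := by
    intro φ
    rw [← hH]
    congr 1
    ext j
    obtain ⟨i, rfl⟩ := (Equiv.swap k l).surjective j
    rw [MeasurableEquiv.coe_piCongrLeft, Equiv.piCongrLeft_apply_apply, Equiv.swap_apply_self, hcs]
  simp_rw [h', integral_neg] at h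
  exact self_eq_neg.1 h.symm

/-- Cancelling the pole of the cross factor of two adjacent variables makes the multiple contour
integral vanish, as soon as the remaining weights of these two variables agree. -/
theorem integral_crossKernel_mul_sub_eq_zero {n : ℕ} {τ t : ℝ} (hτ : τ ∈ Ioo (0 : ℝ) 1)
    (ht : 0 < t) {a : Fin n → ℝ} (hlow : ∀ j, -(1 - τ) < a j) (hup : ∀ j, a j < 0)
    (hmono : StrictMono a) (hcross : ∀ i j, i < j → τ * a i < a j) {x : Fin n → ℝ} {k l : Fin n}
    (hkl : (k : ℕ) + 1 = l) (hx : x k = x l) :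
    ∫ φ : Fin n → ℝ, crossKernel τ t x (ltPairsErase k l) (fun j => lineZ (a j) (φ j)) *
      (lineZ (a l) (φ l) - lineZ (a k) (φ k)) = 0 := by
  have hlt : k < l := by rw [Fin.lt_def]; omega
  have hakl : a k ≤ a l := (hmono hlt).le
  obtain ⟨δ, hδ, hgap⟩ := exists_contourGap hτ.1.le (ltPairsErase k l) (c := a)
    (c' := Function.update a k (a l)) (fun j => by linarith [hlow j])
    (fun j => by
      by_cases hj : j = k
      · subst hj; simpa using hup l
      · simpa [hj] using hup j)
    (fun pr hpr => by
      obtain ⟨p, q⟩ := pr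
      rw [mem_ltPairsErase] at hpr
      by_cases hp : p = k
      · subst hp
        have hq : l < q := by
          simp only [ne_eq, Prod.mk.injEq, true_and, Fin.lt_def, Fin.ext_iff] at hpr ⊢
          omega
        simpa using hcross l q hq
      · simpa [hp] using hcross p q hpr.2)
  have hgap' : ∀ r ∈ Icc (a k) (a l),
      ContourGap τ δ (ltPairsErase k l) (Function.update a k r) := fun r hr =>
    hgap _ (le_update_self_iff.2 hr.1) (update_le_update_iff'.2 hr.2)
  let H : (Fin n → ℂ) → ℂ := fun z => crossKernel τ t x (ltPairsErase k l) z * (z l - z k)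
  obtain ⟨C, hC⟩ := exists_norm_crossKernel_le hτ ht hδ (ltPairsErase k l) x
  have hshift := integral_lineZ_update_eq (H := H) (a := a) (ℓ := k) (K := 2 * C) hakl
    (by positivity : 0 < t / 4) ?_ ?_
  · refine Eq.trans hshift (integral_eq_zero_of_swap_antisymm (k := k) (l := l) ?_ fun z => ?_)
    · simp [hlt.ne']
    · simp only [H, crossKernel_comp_swap hkl hx, Equiv.swap_apply_left, Equiv.swap_apply_right]
      ring
  · intro r hr z hz
    refine (differentiableAt_crossKernel hδ (hgap' r hr) x hz).mul ?_
    fun_prop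
  · intro r hr φ
    have hb := hC _ (hgap' r hr) φ
    have hnorm : ∀ j, ‖lineZ (Function.update a k r j) (φ j)‖ ≤ ∏ j, (1 + |φ j|) := fun j =>
      (norm_lineZ_le ((hgap' r hr).abs_le_one hτ.1.le hδ.le j) _).trans (one_add_abs_le_prod φ j)
    simp only [H]
    rw [norm_mul, mul_assoc 2]
    refine le_trans ?_ (mul_le_mul_of_nonneg_left hb zero_le_two)
    rw [mul_left_comm]
    gcongr
    rw [two_mul]
    exact (norm_sub_le _ _).trans (add_le_add (hnorm l) (hnorm k))

/-- Boundary condition: for `x_ℓ = x_{ℓ+1}`,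
`∂F̃_n/∂x_{ℓ+1} − τ ∂F̃_n/∂x_ℓ = 0`. -/
theorem Ftilde_boundary (n : ℕ) (hn : 1 ≤ n) (τ : ℝ) (hτ : τ ∈ Set.Ioo (0 : ℝ) 1)
    (a : Fin n → ℝ) (hlow : ∀ j, -(1 - τ) < a j) (hup : ∀ j, a j < 0)
    (hmono : StrictMono a)
    (hgap : ∀ i j : Fin n, (i : ℕ) + 1 = (j : ℕ) → τ * a i < a j)
    (t : ℝ) (ht : 0 < t) (ℓ : Fin n) (hℓ : (ℓ : ℕ) + 1 < n)
    (x : Fin n → ℝ) (hx : x ℓ = x ⟨(ℓ : ℕ) + 1, hℓ⟩) :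
    deriv (fun v : ℝ => Ftilde n τ a (Function.update x ⟨(ℓ : ℕ) + 1, hℓ⟩ v) t)
        (x ⟨(ℓ : ℕ) + 1, hℓ⟩) -
      (τ : ℂ) * deriv (fun v : ℝ => Ftilde n τ a (Function.update x ℓ v) t) (x ℓ) = 0 := by
  have hτ' := hτ
  obtain ⟨hτ0, hτ1⟩ := hτ
  set l : Fin n := ⟨(ℓ : ℕ) + 1, hℓ⟩ with hl
  have hkl : (ℓ : ℕ) + 1 = l := rfl
  have hlt : ℓ < l := by rw [Fin.lt_def]; omega
  have hcross : ∀ i j : Fin n, i < j → τ * a i < a j := by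
    intro i j hij
    rw [Fin.lt_def] at hij
    have hj : (j : ℕ) - 1 < n := by omega
    refine lt_of_le_of_lt ?_ (hgap ⟨(j : ℕ) - 1, hj⟩ j (by simp; omega))
    refine mul_le_mul_of_nonneg_left (hmono.monotone ?_) hτ0.le
    rw [Fin.le_def]
    simp only
    omega
  let S : Finset (Fin n × Fin n) := Finset.univ.filter fun pr => pr.1 < pr.2
  obtain ⟨δ, hδ, hgapS⟩ := exists_contourGap hτ0.le S (c := a) (c' := a)
    (fun j => by linarith [hlow j]) hup fun pr hpr =>
      sub_pos.2 (hcross _ _ (by simpa [S] using hpr))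
  have ha := hgapS a le_rfl le_rfl
  have hderiv : ∀ k, deriv (fun v : ℝ => Ftilde n τ a (Function.update x k v) t) (x k) =
      (τ : ℂ) ^ (n * (n - 1) / 2) * (1 / (2 * Real.pi)) ^ n * ∫ φ : Fin n → ℝ,
        crossKernel τ t x S (fun j => lineZ (a j) (φ j)) * lineZ (a k) (φ k) := fun k =>
    ((hasDerivAt_integral_crossKernel hτ' ht hδ ha x k).const_mul _).deriv
  have hint := integrable_crossKernel_mul_lineZ hτ' ht hδ ha x
  have hzero := integral_crossKernel_mul_sub_eq_zero hτ' ht hlow hup hmono hcross hkl hx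
  have hcancel : ∀ φ : Fin n → ℝ,
      crossKernel τ t x S (fun j => lineZ (a j) (φ j)) * lineZ (a l) (φ l) -
        τ * (crossKernel τ t x S (fun j => lineZ (a j) (φ j)) * lineZ (a ℓ) (φ ℓ)) =
      crossKernel τ t x (ltPairsErase ℓ l) (fun j => lineZ (a j) (φ j)) *
        (lineZ (a l) (φ l) - lineZ (a ℓ) (φ ℓ)) := by
    intro φ
    have hmem : (ℓ, l) ∈ S := by simpa [S] using hlt
    have hne := norm_pos_iff.1 (hδ.trans_le (ha.le_norm_sub
      (z := fun j => lineZ (a j) (φ j)) (fun j => lineZ_re _ _) hmem))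
    refine Eq.trans ?_ (crossKernel_mul_sub x hmem hne)
    ring
  rw [hderiv, hderiv, mul_left_comm, ← mul_sub, ← integral_const_mul,
    ← integral_sub (hint l) ((hint ℓ).const_mul _)]
  simp_rw [hcancel, hzero, mul_zero]
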